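/- Let $\varphi=(1+\sqrt5)/2$ and let $\omega_k=2+\lfloor (k+1)\varphi\rfloor-\lfloor (k+2)\varphi\rfloor$, $k\ge 0$, be the Fibonacci word. Let $b>1$, put $$\delta=1-\frac1b+\frac1b\Big(1-\frac1b\Big)\sum_{k\ge 0}\omega_k b^{-k},\qquad \rho=\frac{500b}{b-1}\big(b(1-\delta)+1\big),$$ and let $f:[0,\infty)\to[0,\infty)$ be the piecewise-affine contraction $f(x)=\frac1b x+1000$ if $x<\rho$, $f(x)=\frac1b x+500$ if $x\ge\rho$ (that is, $v_1=1000$, $v_2=500$, $r=\frac1b-1$). For $x\ge 0$ let $\omega_f(x)$ be the set of all $p\in\mathbb R$ for which there are $n_1<n_2<\cdots$ with $f^{n_k}(x)\to p$. Then there is a Cantor set $C\subset[0,\infty)$ (a nonempty, compact, perfect, nowhere dense set) with $\omega_f(S_0)=C$ for all $S_0\ge 0$, and the orbits of $f$ have sensitive dependence on initial conditions at every point of $C$: with $\eta=500\left(1-\frac1b\right)>0$, for every $S_0\in C$ and every $\epsilon>0$ there exist $S_0'\ge 0$ and $k\in\mathbb N$ such that $|S_0'-S_0|\le\epsilon$ and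 $|f^k(S_0')-f^k(S_0)|\ge\eta$. -/

import Mathlib

open Filter Topology

/-- The Fibonacci word `0,1,0,0,1,0,1,0,...`. -/
noncomputable def fibWord (k : ℕ) : ℤ :=
  2 + ⌊((k : ℝ) + 1) * Real.goldenRatio⌋ - ⌊((k : ℝ) + 2) * Real.goldenRatio⌋

noncomputable def fibDelta (b : ℝ) : ℝ :=
  1 - 1 / b + (1 / b) * (1 - 1 / b) * ∑' k : ℕ, (fibWord k : ℝ) * (1 / b) ^ k

noncomputable def rhoParam (b : ℝ) : ℝ :=
  500 * b / (b - 1) * (b * (1 - fibDelta b) + 1)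

/-- The piecewise-affine contraction; for `-1 < r` and `0 ≤ v₁, v₂` it maps `[0,∞)` to itself. -/
noncomputable def pwc (r v₁ v₂ ρ : ℝ) (x : ℝ) : ℝ :=
  if x < ρ then (1 + r) * x + v₁ else (1 + r) * x + v₂

/-- The map with `v₁ = 1000`, `v₂ = 500`, `r = 1/b - 1` and the threshold `rhoParam b`. -/
noncomputable def fibMap (b : ℝ) : ℝ → ℝ :=
  pwc (1 / b - 1) 1000 500 (rhoParam b)

def omegaLim (g : ℝ → ℝ) (x : ℝ) : Set ℝ :=
  {p : ℝ | ∃ n : ℕ → ℕ, StrictMono n ∧ Tendsto (fun k => g^[n k] x) atTop (𝓝 p)}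

def IsCantorSet (C : Set ℝ) : Prop :=
  C.Nonempty ∧ IsCompact C ∧ Perfect C ∧ IsNowhereDense C

/-- Forward orbits of an irrational rotation are dense modulo one. -/
theorem Irrational.exists_nat_mul_sub_int_mem_Ioo {θ : ℝ} (hθ : Irrational θ) (s : ℝ) {a b : ℝ}
    (hab : a < b) : ∃ (n : ℕ) (m : ℤ), s + n * θ - m ∈ Set.Ioo a b := by
  have : Fact ((0 : ℝ) < 1) := ⟨one_pos⟩
  have hd : DenseRange (fun n : ℕ => n • (θ : AddCircle (1 : ℝ))) := by
    rw [← denseRange_zsmul_iff_nsmul, AddCircle.denseRange_zsmul_coe_iff, div_one]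
    exact hθ
  have hU : IsOpen ((fun x : ℝ => (x : AddCircle (1 : ℝ))) '' Set.Ioo (a - s) (b - s)) :=
    QuotientAddGroup.isOpenMap_coe _ isOpen_Ioo
  obtain ⟨n, x, hx, hxn⟩ := hd.exists_mem_open hU
    (Set.Nonempty.image _ (Set.nonempty_Ioo.2 (by linarith)))
  have h0 : ((n * θ - x : ℝ) : AddCircle (1 : ℝ)) = 0 := by
    have : (x : AddCircle (1 : ℝ)) = n • (θ : AddCircle (1 : ℝ)) := hxn
    rw [AddCircle.coe_sub, this, ← nsmul_eq_mul, AddCircle.coe_nsmul, sub_self]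
  obtain ⟨m, hm⟩ := (AddCircle.coe_eq_zero_iff (1 : ℝ)).1 h0
  refine ⟨n, m, ?_⟩
  have : (m : ℝ) = n * θ - x := by simpa using hm
  constructor <;> linarith [hx.1, hx.2]

/-- The increasing jump function conjugating the rotation by `θ` to a contracted rotation
of slope `l`. -/
noncomputable def saltus (l θ t : ℝ) : ℝ :=
  (1 - l) * ∑' k : ℕ, l ^ k * ((⌊t - (k + 1) * θ⌋ - ⌊-((k + 1) * θ)⌋ : ℤ) : ℝ)

section Saltus

variable {l θ : ℝ}

theorem abs_floor_sub_floor_neg_le (t u : ℝ) : |((⌊t - u⌋ - ⌊-u⌋ : ℤ) : ℝ)| ≤ |t| + 1 := by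
  have h1 := Int.floor_le (t - u)
  have h2 := Int.lt_floor_add_one (t - u)
  have h3 := Int.floor_le (-u)
  have h4 := Int.lt_floor_add_one (-u)
  push_cast
  rw [abs_le]
  constructor <;> linarith [le_abs_self t, neg_abs_le t]

theorem norm_saltus_term_le (hl0 : 0 < l) (t : ℝ) (k : ℕ) :
    ‖l ^ k * ((⌊t - (k + 1) * θ⌋ - ⌊-((k + 1) * θ)⌋ : ℤ) : ℝ)‖ ≤ l ^ k * (|t| + 1) := by
  rw [norm_mul, Real.norm_of_nonneg (pow_pos hl0 k).le, Real.norm_eq_abs]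
  exact mul_le_mul_of_nonneg_left (abs_floor_sub_floor_neg_le _ _) (pow_pos hl0 k).le

theorem summable_saltus (hl0 : 0 < l) (hl1 : l < 1) (t : ℝ) :
    Summable fun k : ℕ => l ^ k * ((⌊t - (k + 1) * θ⌋ - ⌊-((k + 1) * θ)⌋ : ℤ) : ℝ) :=
  ((summable_geometric_of_lt_one hl0.le hl1).mul_right (|t| + 1)).of_norm_bounded
    (norm_saltus_term_le hl0 t)

@[simp]
theorem saltus_zero : saltus l θ 0 = 0 := by
  simp [saltus]

theorem saltus_add_int (hl0 : 0 < l) (hl1 : l < 1) (t : ℝ) (m : ℤ) :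
    saltus l θ (t + m) = saltus l θ t + m := by
  have h (k : ℕ) : l ^ k * ((⌊t + m - (k + 1) * θ⌋ - ⌊-((k + 1) * θ)⌋ : ℤ) : ℝ) =
      l ^ k * ((⌊t - (k + 1) * θ⌋ - ⌊-((k + 1) * θ)⌋ : ℤ) : ℝ) + l ^ k * m := by
    rw [show t + m - (k + 1) * θ = t - (k + 1) * θ + m by ring, Int.floor_add_intCast]
    push_cast
    ring
  unfold saltus
  rw [tsum_congr h, (summable_saltus hl0 hl1 t).tsum_add
    ((summable_geometric_of_lt_one hl0.le hl1).mul_right _), tsum_mul_right,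
    tsum_geometric_of_lt_one hl0.le hl1]
  rw [mul_add, mul_inv_cancel_left₀ (by linarith)]

theorem saltus_intCast (hl0 : 0 < l) (hl1 : l < 1) (m : ℤ) : saltus l θ m = m := by
  simpa using saltus_add_int (θ := θ) hl0 hl1 0 m

theorem saltus_strictMono (hl0 : 0 < l) (hl1 : l < 1) (hθ : Irrational θ) :
    StrictMono (saltus l θ) := by
  intro t t' h
  refine mul_lt_mul_of_pos_left ?_ (by linarith)
  have hmono (k : ℕ) : ⌊t - (k + 1) * θ⌋ ≤ ⌊t' - (k + 1) * θ⌋ := Int.floor_le_floor (by linarith)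
  obtain ⟨k, m, h1, h2⟩ := hθ.exists_nat_mul_sub_int_mem_Ioo θ h
  refine (summable_saltus hl0 hl1 t).tsum_lt_tsum (i := k) (fun j => ?_) ?_
    (summable_saltus hl0 hl1 t')
  · refine mul_le_mul_of_nonneg_left ?_ (pow_pos hl0 j).le
    exact Int.cast_le.2 (sub_le_sub_right (hmono j) _)
  · refine mul_lt_mul_of_pos_left ?_ (pow_pos hl0 k)
    have : ⌊t - (k + 1) * θ⌋ < ⌊t' - (k + 1) * θ⌋ := by
      have h3 : ⌊t - (k + 1) * θ⌋ < -m := by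
        rw [Int.floor_lt]; push_cast; linarith
      have h4 : -m ≤ ⌊t' - (k + 1) * θ⌋ := by
        rw [Int.le_floor]; push_cast; linarith
      exact h3.trans_le h4
    exact Int.cast_lt.2 (sub_lt_sub_right this _)

theorem floor_saltus (hl0 : 0 < l) (hl1 : l < 1) (hθ : Irrational θ) (t : ℝ) :
    ⌊saltus l θ t⌋ = ⌊t⌋ := by
  have hm := saltus_strictMono hl0 hl1 hθ
  rw [Int.floor_eq_iff]
  constructor
  · rw [← saltus_intCast (θ := θ) hl0 hl1]
    exact hm.monotone (Int.floor_le t)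
  · rw [← Int.cast_one, ← Int.cast_add, ← saltus_intCast (θ := θ) hl0 hl1]
    exact hm (by push_cast; exact Int.lt_floor_add_one t)

theorem saltus_fract (hl0 : 0 < l) (hl1 : l < 1) (t : ℝ) :
    saltus l θ (Int.fract t) = saltus l θ t - ⌊t⌋ := by
  have := saltus_add_int (θ := θ) hl0 hl1 t (-⌊t⌋)
  push_cast at this
  rw [Int.fract, sub_eq_add_neg, this]
  ring

theorem saltus_add_self (hl0 : 0 < l) (hl1 : l < 1) (t : ℝ) :
    saltus l θ (t + θ) = (1 - l) * (⌊t⌋ - ⌊-θ⌋) + (1 - l) * ∑' k : ℕ, l ^ (k + 1) *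
      ((⌊t - (k + 1) * θ⌋ - ⌊-((k + 2) * θ)⌋ : ℤ) : ℝ) := by
  unfold saltus
  rw [(summable_saltus hl0 hl1 _).tsum_eq_zero_add, mul_add]
  congr 2
  · simp
  · refine tsum_congr fun k => ?_
    rw [show t + θ - (((k + 1 : ℕ) : ℝ) + 1) * θ = t - (k + 1) * θ by push_cast; ring,
      show (((k + 1 : ℕ) : ℝ) + 1) * θ = (k + 2) * θ by push_cast; ring]

theorem summable_saltus_shift (hl0 : 0 < l) (hl1 : l < 1) (t : ℝ) :
    Summable fun k : ℕ => l ^ (k + 1) * ((⌊t - (k + 1) * θ⌋ - ⌊-((k + 2) * θ)⌋ : ℤ) : ℝ) := by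
  refine ((summable_nat_add_iff 1).2 (summable_saltus (θ := θ) hl0 hl1 (t + θ))).congr
    fun k => ?_
  rw [show t + θ - (((k + 1 : ℕ) : ℝ) + 1) * θ = t - (k + 1) * θ by push_cast; ring,
      show (((k + 1 : ℕ) : ℝ) + 1) * θ = (k + 2) * θ by push_cast; ring]

/-- `saltus` conjugates the translation by `θ` to the lift of a contracted rotation. -/
theorem saltus_add_rotation (hl0 : 0 < l) (hl1 : l < 1) (t : ℝ) :
    saltus l θ (t + θ) = l * saltus l θ t + saltus l θ θ + (1 - l) * ⌊t⌋ := by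
  have h0 := saltus_add_self (θ := θ) hl0 hl1 0
  rw [zero_add] at h0
  have hs : ∑' k : ℕ, l ^ (k + 1) * ((⌊t - (k + 1) * θ⌋ - ⌊-((k + 2) * θ)⌋ : ℤ) : ℝ) =
      l * (∑' k : ℕ, l ^ k * ((⌊t - (k + 1) * θ⌋ - ⌊-((k + 1) * θ)⌋ : ℤ) : ℝ)) +
      ∑' k : ℕ, l ^ (k + 1) * ((⌊0 - (k + 1) * θ⌋ - ⌊-((k + 2) * θ)⌋ : ℤ) : ℝ) := by
    rw [← tsum_mul_left, ← ((summable_saltus hl0 hl1 t).mul_left l).tsum_add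
      (summable_saltus_shift hl0 hl1 0)]
    refine tsum_congr fun k => ?_
    rw [zero_sub]
    push_cast
    ring
  rw [saltus_add_self hl0 hl1, h0, hs, saltus]
  simp only [Int.floor_zero, Int.cast_zero]
  ring

theorem tendsto_saltus {F : Filter ℝ} {t : ℝ} (hl0 : 0 < l) (hl1 : l < 1) (hF : F ≤ 𝓝 t)
    (h : ∀ k : ℕ, ∀ᶠ s in F, ⌊s - (k + 1) * θ⌋ = ⌊t - (k + 1) * θ⌋) :
    Tendsto (saltus l θ) F (𝓝 (saltus l θ t)) := by
  refine Tendsto.const_mul _ (tendsto_tsum_of_dominated_convergence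
    (bound := fun k : ℕ => l ^ k * (|t| + 1 + 1))
    ((summable_geometric_of_lt_one hl0.le hl1).mul_right _) (fun k => ?_) ?_)
  · refine tendsto_const_nhds.congr' ?_
    filter_upwards [h k] with s hs
    rw [hs]
  · have : ∀ᶠ s in F, |s| < |t| + 1 :=
      hF (continuous_abs.continuousAt.eventually_lt continuousAt_const (lt_add_one _))
    filter_upwards [this] with s hs k
    refine (norm_saltus_term_le hl0 s k).trans ?_
    exact mul_le_mul_of_nonneg_left (by linarith) (pow_pos hl0 k).le

theorem tendsto_saltus_nhdsGT (hl0 : 0 < l) (hl1 : l < 1) (t : ℝ) :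
    Tendsto (saltus l θ) (𝓝[>] t) (𝓝 (saltus l θ t)) := by
  refine tendsto_saltus hl0 hl1 nhdsWithin_le_nhds fun k => ?_
  have h1 := Int.lt_floor_add_one (t - (k + 1) * θ)
  filter_upwards [Ioo_mem_nhdsGT (show t < ⌊t - (k + 1) * θ⌋ + 1 + (k + 1) * θ by linarith)]
    with s hs
  rw [Int.floor_eq_iff]
  constructor <;> linarith [Int.floor_le (t - (k + 1) * θ), hs.1, hs.2]

theorem continuousAt_saltus_intCast (hl0 : 0 < l) (hl1 : l < 1) (hθ : Irrational θ) (m : ℤ) :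
    ContinuousAt (saltus l θ) m := by
  refine tendsto_saltus hl0 hl1 le_rfl fun k => ?_
  have hirr : Irrational (m - (k + 1) * θ) := by
    have : Irrational (((k + 1 : ℕ) : ℝ) * θ) := hθ.natCast_mul (Nat.succ_ne_zero k)
    push_cast at this
    exact this.intCast_sub m
  have h1 : (⌊m - (k + 1) * θ⌋ : ℝ) < m - (k + 1) * θ :=
    lt_of_le_of_ne (Int.floor_le _) (hirr.ne_int _).symm
  have h2 := Int.lt_floor_add_one ((m : ℝ) - (k + 1) * θ)
  filter_upwards [Ioo_mem_nhds
    (show (⌊(m : ℝ) - (k + 1) * θ⌋ : ℝ) + (k + 1) * θ < m by linarith)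
    (show (m : ℝ) < ⌊(m : ℝ) - (k + 1) * θ⌋ + 1 + (k + 1) * θ by linarith)] with s hs
  rw [Int.floor_eq_iff]
  constructor <;> linarith [hs.1, hs.2]

end Saltus

/-- The contracted rotation with slope `l` and translation `δ`. -/
noncomputable def contractedRot (l δ y : ℝ) : ℝ :=
  if y < (1 - δ) / l then l * y + δ else l * y + δ - 1

/-- The lift to the line of the contracted rotation with slope `l` and translation `δ`. -/
noncomputable def rotLift (l δ y : ℝ) : ℝ :=
  l * y + δ + (1 - l) * ⌊y⌋

section ContractedRot

variable {l δ : ℝ}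

theorem rotLift_monotone (hl0 : 0 < l) (hl1 : l < 1) : Monotone (rotLift l δ) := by
  intro x y h
  have h1 := mul_le_mul_of_nonneg_left h hl0.le
  have h2 : (1 - l) * ⌊x⌋ ≤ (1 - l) * ⌊y⌋ :=
    mul_le_mul_of_nonneg_left (Int.cast_le.2 (Int.floor_le_floor h)) (by linarith)
  unfold rotLift
  linarith

theorem semiconj_fract_rotLift (hl0 : 0 < l) (hl1 : l < 1) (hδ0 : 0 ≤ δ) (hδ1 : δ < 1) :
    Function.Semiconj Int.fract (rotLift l δ) (contractedRot l δ) := by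
  intro y
  have h0 := Int.fract_nonneg y
  have h1 := Int.fract_lt_one y
  have h2 : l * Int.fract y < 1 := by nlinarith
  have h3 : 0 ≤ l * Int.fract y := by positivity
  have e : rotLift l δ y = l * Int.fract y + δ + ⌊y⌋ := by
    rw [rotLift, Int.fract]; ring
  rw [e, Int.fract_add_intCast, contractedRot]
  split_ifs with h
  · rw [lt_div_iff₀ hl0] at h
    exact Int.fract_eq_iff.2 ⟨by linarith, by linarith, 0, by simp⟩
  · rw [not_lt, div_le_iff₀ hl0] at h
    exact Int.fract_eq_iff.2 ⟨by linarith, by linarith, 1, by simp⟩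

theorem contractedRot_mem_Icc (hl0 : 0 < l) (hδ0 : 0 ≤ δ) (hδ1 : δ < 1) (hl1 : l < 1) {y : ℝ}
    (hy : y ∈ Set.Icc (0 : ℝ) 1) : contractedRot l δ y ∈ Set.Icc (0 : ℝ) 1 := by
  have h2 : l * y ≤ l := by nlinarith [hy.2]
  have h3 : 0 ≤ l * y := mul_nonneg hl0.le hy.1
  unfold contractedRot
  split_ifs with h
  · rw [lt_div_iff₀ hl0] at h
    constructor <;> linarith
  · rw [not_lt, div_le_iff₀ hl0] at h
    constructor <;> linarith

theorem contractedRot_iterate_mem_Icc (hl0 : 0 < l) (hδ0 : 0 ≤ δ) (hδ1 : δ < 1) (hl1 : l < 1)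
    {y : ℝ} (hy : y ∈ Set.Icc (0 : ℝ) 1) (n : ℕ) :
    (contractedRot l δ)^[n] y ∈ Set.Icc (0 : ℝ) 1 := by
  induction n with
  | zero => exact hy
  | succ n ih =>
    rw [Function.iterate_succ_apply']
    exact contractedRot_mem_Icc hl0 hδ0 hδ1 hl1 ih

/-- Every orbit of a contracted rotation enters the unit interval. -/
theorem exists_contractedRot_iterate_mem_Ico (hl0 : 0 < l) (hl1 : l < 1) (hδ0 : 0 < δ)
    (hδ1 : δ < 1) (hlδ : 1 < l + δ) (y : ℝ) :
    ∃ n : ℕ, (contractedRot l δ)^[n] y ∈ Set.Ico (0 : ℝ) 1 := by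
  by_contra! hne
  have hc0 : 0 < (1 - δ) / l := div_pos (by linarith) hl0
  have hc1 : (1 - δ) / l < 1 := by rw [div_lt_one hl0]; linarith
  rcases lt_or_ge y 0 with hy | hy
  · have key (n : ℕ) : (contractedRot l δ)^[n] y < 0 ∧
        y + n * δ ≤ (contractedRot l δ)^[n] y := by
      induction n with
      | zero => simpa using hy
      | succ n ih =>
        have hn := hne (n + 1)
        rw [Function.iterate_succ_apply'] at hn ⊢
        set z := (contractedRot l δ)^[n] y
        have e : contractedRot l δ z = l * z + δ := if_pos (ih.1.trans hc0)
        rw [e] at hn ⊢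
        have h1 : l * z < 0 := mul_neg_of_pos_of_neg hl0 ih.1
        have h2 : z ≤ l * z := by nlinarith [ih.1]
        refine ⟨?_, by push_cast; linarith [ih.2]⟩
        by_contra! h
        exact hn ⟨h, by linarith⟩
    obtain ⟨n, hn⟩ := exists_nat_gt (-y / δ)
    rw [div_lt_iff₀ hδ0] at hn
    linarith [(key n).1, (key n).2]
  · have hy1 : 1 ≤ y := by
      by_contra! h
      exact hne 0 ⟨hy, h⟩
    have key (n : ℕ) : 1 ≤ (contractedRot l δ)^[n] y ∧
        (contractedRot l δ)^[n] y ≤ y - n * (1 - δ) := by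
      induction n with
      | zero => simpa using hy1
      | succ n ih =>
        have hn := hne (n + 1)
        rw [Function.iterate_succ_apply'] at hn ⊢
        set z := (contractedRot l δ)^[n] y
        have e : contractedRot l δ z = l * z + δ - 1 :=
          if_neg (not_lt.2 (hc1.le.trans ih.1))
        rw [e] at hn ⊢
        have h1 : l ≤ l * z := by nlinarith [ih.1]
        have h2 : l * z ≤ z := by nlinarith [ih.1]
        refine ⟨?_, by push_cast; linarith [ih.2]⟩
        by_contra! h
        exact hn ⟨by linarith, h⟩
    obtain ⟨n, hn⟩ := exists_nat_gt (y / (1 - δ))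
    rw [div_lt_iff₀ (by linarith)] at hn
    linarith [(key n).1, (key n).2]

/-- Two points of the unit interval on different sides of the discontinuity are mapped far apart. -/
theorem le_abs_contractedRot_sub (hl0 : 0 < l) {y z : ℝ} (hy : y ∈ Set.Icc (0 : ℝ) 1)
    (hz : z ∈ Set.Icc (0 : ℝ) 1) (h : ¬(y < (1 - δ) / l ↔ z < (1 - δ) / l)) :
    1 - l ≤ |contractedRot l δ y - contractedRot l δ z| := by
  obtain ⟨hy0, hy1⟩ := hy
  obtain ⟨hz0, hz1⟩ := hz
  unfold contractedRot
  split_ifs with h1 h2 h2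
  · exact absurd (iff_of_true h1 h2) h
  · exact le_abs.2 (Or.inl (by nlinarith))
  · exact le_abs.2 (Or.inr (by nlinarith))
  · exact absurd (iff_of_false h1 h2) h

end ContractedRot

section Conjugacy

variable {l θ : ℝ}

theorem saltus_self_pos (hl0 : 0 < l) (hl1 : l < 1) (hθ : Irrational θ) (hθ0 : 0 < θ) :
    0 < saltus l θ θ := by
  simpa using saltus_strictMono hl0 hl1 hθ hθ0

theorem saltus_one (hl0 : 0 < l) (hl1 : l < 1) : saltus l θ 1 = 1 := by
  simpa using saltus_intCast (θ := θ) hl0 hl1 1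

theorem saltus_self_lt_one (hl0 : 0 < l) (hl1 : l < 1) (hθ : Irrational θ) (hθ1 : θ < 1) :
    saltus l θ θ < 1 := by
  simpa [saltus_one hl0 hl1] using saltus_strictMono hl0 hl1 hθ hθ1

/-- The discontinuity of the contracted rotation. -/
theorem saltus_one_sub (hl0 : 0 < l) (hl1 : l < 1) (hθ0 : 0 < θ) (hθ1 : θ < 1) :
    saltus l θ (1 - θ) = (1 - saltus l θ θ) / l := by
  have h := saltus_add_rotation (θ := θ) hl0 hl1 (1 - θ)
  have hf : ⌊1 - θ⌋ = 0 := Int.floor_eq_zero_iff.2 ⟨by linarith, by linarith⟩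
  rw [sub_add_cancel, saltus_one hl0 hl1, hf, Int.cast_zero] at h
  rw [eq_div_iff hl0.ne']
  linarith

theorem one_lt_add_saltus_self (hl0 : 0 < l) (hl1 : l < 1) (hθ : Irrational θ) (hθ0 : 0 < θ)
    (hθ1 : θ < 1) : 1 < l + saltus l θ θ := by
  have h := saltus_strictMono hl0 hl1 hθ (show 1 - θ < 1 by linarith)
  rw [saltus_one hl0 hl1, saltus_one_sub hl0 hl1 hθ0 hθ1, div_lt_one hl0] at h
  linarith

theorem rotLift_iterate_saltus (hl0 : 0 < l) (hl1 : l < 1) (hθ : Irrational θ) (t : ℝ) (n : ℕ) :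
    (rotLift l (saltus l θ θ))^[n] (saltus l θ t) = saltus l θ (t + n * θ) := by
  induction n with
  | zero => simp
  | succ n ih =>
    rw [Function.iterate_succ_apply', ih, rotLift, floor_saltus hl0 hl1 hθ,
      ← saltus_add_rotation hl0 hl1]
    congr 1
    push_cast
    ring

theorem contractedRot_iterate_saltus_fract (hl0 : 0 < l) (hl1 : l < 1) (hθ : Irrational θ)
    (hθ0 : 0 < θ) (hθ1 : θ < 1) (t : ℝ) (n : ℕ) :
    (contractedRot l (saltus l θ θ))^[n] (saltus l θ (Int.fract t)) =
      saltus l θ (Int.fract (t + n * θ)) := by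
  have hc := (semiconj_fract_rotLift hl0 hl1 (saltus_self_pos hl0 hl1 hθ hθ0).le
    (saltus_self_lt_one hl0 hl1 hθ hθ1)).iterate_right n (saltus l θ t)
  rw [rotLift_iterate_saltus hl0 hl1 hθ] at hc
  simp only [Int.fract, floor_saltus hl0 hl1 hθ] at hc
  rw [saltus_fract hl0 hl1, saltus_fract hl0 hl1, hc]

/-- Every orbit of the lift is exponentially asymptotic to an orbit in the range of `saltus`. -/
theorem exists_saltus_shadow (hl0 : 0 < l) (hl1 : l < 1) (hθ : Irrational θ) (y : ℝ) :
    ∃ t : ℝ, ∀ n : ℕ, ⌊(rotLift l (saltus l θ θ))^[n] y⌋ = ⌊t + n * θ⌋ ∧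
      saltus l θ (t + n * θ) - (rotLift l (saltus l θ θ))^[n] y =
        l ^ n * (saltus l θ t - y) := by
  have hψ := saltus_strictMono hl0 hl1 hθ
  have hF (n : ℕ) := (rotLift_monotone (δ := saltus l θ θ) hl0 hl1).iterate n
  set A : Set ℝ := {s | saltus l θ s ≤ y} with hA
  have hne : A.Nonempty := ⟨⌊y⌋, by
    rw [hA, Set.mem_ofPred_eq, saltus_intCast hl0 hl1]; exact Int.floor_le y⟩
  have hbdd : BddAbove A := by
    refine ⟨((⌊y⌋ + 1 : ℤ) : ℝ), fun s hs => ?_⟩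
    by_contra! h
    have := hψ h
    rw [saltus_intCast hl0 hl1] at this
    push_cast at this
    have h2 : saltus l θ s ≤ y := hs
    linarith [Int.lt_floor_add_one y]
  set t := sSup A
  have hlow (s : ℝ) (hs : s < t) : saltus l θ s ≤ y := by
    obtain ⟨u, hu, hsu⟩ := exists_lt_of_lt_csSup hne hs
    exact (hψ hsu).le.trans hu
  have hup : y ≤ saltus l θ t := by
    refine ge_of_tendsto (tendsto_saltus_nhdsGT hl0 hl1 t) ?_
    filter_upwards [self_mem_nhdsWithin] with s hs
    by_contra! h
    exact absurd (le_csSup hbdd h.le) (not_le.2 hs)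
  have hfloor (n : ℕ) : ⌊(rotLift l (saltus l θ θ))^[n] y⌋ = ⌊t + n * θ⌋ := by
    refine le_antisymm ?_ ?_
    · rw [← floor_saltus hl0 hl1 hθ (t + n * θ), ← rotLift_iterate_saltus hl0 hl1 hθ]
      exact Int.floor_le_floor (hF n hup)
    · rw [Int.le_floor]
      set m := ⌊t + n * θ⌋ with hm
      have hlim : Tendsto (saltus l θ) (𝓝[<] (m : ℝ)) (𝓝 (m : ℝ)) := by
        have := (continuousAt_saltus_intCast hl0 hl1 hθ m).tendsto
        rw [saltus_intCast hl0 hl1] at this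
        exact this.mono_left nhdsWithin_le_nhds
      refine le_of_tendsto hlim ?_
      filter_upwards [self_mem_nhdsWithin] with s hs
      have hs' : s < m := hs
      have h1 : s - n * θ < t := by linarith [Int.floor_le (t + n * θ)]
      have h2 := hF n (hlow _ h1)
      rwa [rotLift_iterate_saltus hl0 hl1 hθ, sub_add_cancel] at h2
  refine ⟨t, fun n => ⟨hfloor n, ?_⟩⟩
  induction n with
  | zero => simp
  | succ n ih =>
    rw [← rotLift_iterate_saltus hl0 hl1 hθ] at ih ⊢
    rw [Function.iterate_succ_apply', Function.iterate_succ_apply', pow_succ']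
    have e1 : ⌊(rotLift l (saltus l θ θ))^[n] (saltus l θ t)⌋ = ⌊t + n * θ⌋ := by
      rw [rotLift_iterate_saltus hl0 hl1 hθ, floor_saltus hl0 hl1 hθ]
    rw [rotLift, rotLift, e1, hfloor n, mul_assoc, ← ih]
    ring

/-- Every orbit of the contracted rotation is asymptotic to an orbit in the range of `saltus`. -/
theorem exists_tendsto_contractedRot_sub_saltus (hl0 : 0 < l) (hl1 : l < 1) (hθ : Irrational θ)
    (hθ0 : 0 < θ) (hθ1 : θ < 1) (y : ℝ) :
    ∃ t : ℝ, Tendsto (fun n : ℕ => (contractedRot l (saltus l θ θ))^[n] y -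
      saltus l θ (Int.fract (t + n * θ))) atTop (𝓝 0) := by
  have hδ0 := saltus_self_pos hl0 hl1 hθ hθ0
  have hδ1 := saltus_self_lt_one hl0 hl1 hθ hθ1
  obtain ⟨N, hN⟩ := exists_contractedRot_iterate_mem_Ico hl0 hl1 hδ0 hδ1
    (one_lt_add_saltus_self hl0 hl1 hθ hθ0 hθ1) y
  set z := (contractedRot l (saltus l θ θ))^[N] y with hz
  obtain ⟨t, ht⟩ := exists_saltus_shadow hl0 hl1 hθ z
  refine ⟨t - N * θ, (tendsto_add_atTop_iff_nat N).1 ?_⟩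
  have hlim : Tendsto (fun n : ℕ => -(l ^ n * (saltus l θ t - z))) atTop (𝓝 0) := by
    simpa using ((tendsto_pow_atTop_nhds_zero_of_lt_one hl0.le hl1).mul_const
      (saltus l θ t - z)).neg
  refine hlim.congr fun n => ?_
  have h1 := (semiconj_fract_rotLift hl0 hl1 hδ0.le hδ1).iterate_right n z
  rw [Int.fract_eq_self.2 hN] at h1
  rw [Function.iterate_add_apply, ← hz, ← h1, Int.fract, (ht n).1, saltus_fract hl0 hl1,
    show t - N * θ + ((n + N : ℕ) : ℝ) * θ = t + n * θ by push_cast; ring, ← (ht n).2]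
  ring

end Conjugacy

section OmegaLimit

theorem mem_omegaLim_iff {g : ℝ → ℝ} {x p : ℝ} :
    p ∈ omegaLim g x ↔ MapClusterPt p atTop fun n => g^[n] x := by
  constructor
  · rintro ⟨n, hn, h⟩
    exact MapClusterPt.of_comp hn.tendsto_atTop h.mapClusterPt
  · exact fun h => h.tendsto_subseq

theorem isClosed_omegaLim (g : ℝ → ℝ) (x : ℝ) : IsClosed (omegaLim g x) := by
  have : omegaLim g x = {p | ClusterPt p (map (fun n => g^[n] x) atTop)} :=
    Set.ext fun _ => mem_omegaLim_iff
  rw [this]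
  exact isClosed_setOfPred_clusterPt

theorem omegaLim_image {f g : ℝ → ℝ} (h : ℝ ≃ₜ ℝ) (hc : Function.Semiconj h g f) (x : ℝ) :
    omegaLim f (h x) = h '' omegaLim g x := by
  have e (n : ℕ) : f^[n] (h x) = h (g^[n] x) := (hc.iterate_right n x).symm
  ext p
  constructor
  · rintro ⟨n, hn, hp⟩
    refine ⟨h.symm p, ⟨n, hn, ?_⟩, h.apply_symm_apply p⟩
    refine ((h.symm.continuous.tendsto p).comp hp).congr fun k => ?_
    simp [e]
  · rintro ⟨q, ⟨n, hn, hq⟩, rfl⟩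
    refine ⟨n, hn, ((h.continuous.tendsto q).comp hq).congr fun k => ?_⟩
    simp [e]

end OmegaLimit

/-- The attractor of the contracted rotation of slope `l` and rotation number `θ`. -/
def rotAttractor (l θ : ℝ) : Set ℝ :=
  closure (saltus l θ '' Set.Ico 0 1)

section Attractor

variable {l θ : ℝ}

theorem saltus_mem_Ico (hl0 : 0 < l) (hl1 : l < 1) (hθ : Irrational θ) {s : ℝ}
    (hs : s ∈ Set.Ico (0 : ℝ) 1) : saltus l θ s ∈ Set.Ico (0 : ℝ) 1 := by
  have hψ := saltus_strictMono hl0 hl1 hθ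
  refine ⟨?_, ?_⟩
  · simpa using hψ.monotone hs.1
  · simpa [saltus_one hl0 hl1] using hψ hs.2

theorem rotAttractor_subset_Icc (hl0 : 0 < l) (hl1 : l < 1) (hθ : Irrational θ) :
    rotAttractor l θ ⊆ Set.Icc 0 1 := by
  refine closure_minimal ?_ isClosed_Icc
  rintro _ ⟨s, hs, rfl⟩
  exact Set.Ico_subset_Icc_self (saltus_mem_Ico hl0 hl1 hθ hs)

/-- Points of the range of `saltus` are approximated from the right within the range. -/
theorem exists_saltus_near (hl0 : 0 < l) (hl1 : l < 1) {s : ℝ} (hs : s < 1) {U : Set ℝ}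
    (hU : U ∈ 𝓝 (saltus l θ s)) :
    ∃ u, s < u ∧ u ≤ 1 ∧ ∀ s' ∈ Set.Ioo s u, saltus l θ s' ∈ U := by
  obtain ⟨u, hu, h⟩ := (mem_nhdsGT_iff_exists_Ioo_subset' hs).1
    (tendsto_saltus_nhdsGT (θ := θ) hl0 hl1 s hU)
  exact ⟨min u 1, lt_min hu hs, min_le_right _ _,
    fun s' hs' => h ⟨hs'.1, hs'.2.trans_le (min_le_left _ _)⟩⟩

theorem perfect_rotAttractor (hl0 : 0 < l) (hl1 : l < 1) (hθ : Irrational θ) :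
    Perfect (rotAttractor l θ) := by
  refine Preperfect.perfect_closure ?_
  rintro _ ⟨s, hs, rfl⟩
  rw [accPt_iff_nhds]
  intro U hU
  obtain ⟨u, hu, hu1, h⟩ := exists_saltus_near hl0 hl1 hs.2 hU
  obtain ⟨s', hs'⟩ := exists_between hu
  refine ⟨saltus l θ s', ⟨h s' hs', s', ⟨hs.1.trans hs'.1.le, hs'.2.trans_le hu1⟩, rfl⟩, ?_⟩
  exact (saltus_strictMono hl0 hl1 hθ hs'.1).ne'

theorem omegaLim_contractedRot (hl0 : 0 < l) (hl1 : l < 1) (hθ : Irrational θ)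
    (hθ0 : 0 < θ) (hθ1 : θ < 1) (y : ℝ) :
    omegaLim (contractedRot l (saltus l θ θ)) y = rotAttractor l θ := by
  obtain ⟨t, ht⟩ := exists_tendsto_contractedRot_sub_saltus hl0 hl1 hθ hθ0 hθ1 y
  refine Set.Subset.antisymm ?_ (closure_minimal ?_ (isClosed_omegaLim _ _))
  · rintro p ⟨n, hn, hp⟩
    refine mem_closure_of_tendsto (by simpa using hp.sub (ht.comp hn.tendsto_atTop))
      (Eventually.of_forall fun k => ?_)
    refine ⟨Int.fract (t + n k * θ), ⟨Int.fract_nonneg _, Int.fract_lt_one _⟩, by simp⟩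
  · rintro _ ⟨s, hs, rfl⟩
    rw [mem_omegaLim_iff]
    have hc : MapClusterPt (saltus l θ s) atTop
        fun n : ℕ => saltus l θ (Int.fract (t + n * θ)) := by
      rw [mapClusterPt_iff_frequently]
      intro U hU
      obtain ⟨u, hu, hu1, h⟩ := exists_saltus_near hl0 hl1 hs.2 hU
      rw [frequently_atTop]
      intro N
      obtain ⟨n, m, hnm⟩ := hθ.exists_nat_mul_sub_int_mem_Ioo (t + N * θ) hu
      refine ⟨N + n, Nat.le_add_right _ _, h _ ?_⟩
      have e : Int.fract (t + ((N + n : ℕ) : ℝ) * θ) = t + N * θ + n * θ - m :=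
        Int.fract_eq_iff.2 ⟨hs.1.trans hnm.1.le, hnm.2.trans_le hu1, m, by push_cast; ring⟩
      rwa [e]
    rw [mapClusterPt_iff_frequently]
    intro U hU
    obtain ⟨ε, hε, hball⟩ := Metric.mem_nhds_iff.1 hU
    have h1 := (mapClusterPt_iff_frequently.1 hc) _ (Metric.ball_mem_nhds _ (half_pos hε))
    have h2 := ht.eventually (Metric.ball_mem_nhds (0 : ℝ) (half_pos hε))
    refine (h1.and_eventually h2).mono fun n hn => hball ?_
    obtain ⟨ha, hb⟩ := hn
    rw [Metric.mem_ball, Real.dist_eq, abs_lt] at *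
    constructor <;> linarith [ha.1, ha.2, hb.1, hb.2]

open scoped Pointwise in
theorem volume_image_mul_add (hl0 : 0 < l) (a : ℝ) (s : Set ℝ) :
    MeasureTheory.volume ((fun x => l * x + a) '' s) =
      ENNReal.ofReal l * MeasureTheory.volume s := by
  have : (fun x => l * x + a) '' s = (fun x => x + a) '' (l • s) := by
    rw [← Set.image_smul, Set.image_image]
    rfl
  rw [this, Set.image_add_right, MeasureTheory.measure_preimage_add_right,
    MeasureTheory.Measure.addHaar_smul_of_nonneg _ hl0.le]
  simp

theorem rotAttractor_subset_union_image (hl0 : 0 < l) (hl1 : l < 1) (hθ : Irrational θ)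
    (hθ0 : 0 < θ) (hθ1 : θ < 1) :
    rotAttractor l θ ⊆
      (fun x => l * x + saltus l θ θ) '' (rotAttractor l θ ∩ Set.Iic (saltus l θ (1 - θ))) ∪
      (fun x => l * x + (saltus l θ θ - 1)) ''
        (rotAttractor l θ ∩ Set.Ici (saltus l θ (1 - θ))) := by
  have hcpt : IsCompact (rotAttractor l θ) :=
    isCompact_Icc.of_isClosed_subset isClosed_closure (rotAttractor_subset_Icc hl0 hl1 hθ)
  refine closure_minimal ?_ (IsClosed.union
    ((hcpt.inter_right isClosed_Iic).image (by fun_prop)).isClosed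
    ((hcpt.inter_right isClosed_Ici).image (by fun_prop)).isClosed)
  rintro _ ⟨s, hs, rfl⟩
  set u := Int.fract (s - θ) with hu
  have hmem : u ∈ Set.Ico (0 : ℝ) 1 := ⟨Int.fract_nonneg _, Int.fract_lt_one _⟩
  have hC : saltus l θ u ∈ rotAttractor l θ := subset_closure ⟨u, hmem, rfl⟩
  have e := contractedRot_iterate_saltus_fract hl0 hl1 hθ hθ0 hθ1 (s - θ) 1
  rw [Function.iterate_one, Nat.cast_one, one_mul, sub_add_cancel, Int.fract_eq_self.2 hs, ← hu,
    contractedRot, ← saltus_one_sub hl0 hl1 hθ0 hθ1] at e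
  split_ifs at e with h
  · exact Or.inl ⟨_, ⟨hC, h.le⟩, e⟩
  · exact Or.inr ⟨_, ⟨hC, not_lt.1 h⟩, by rw [← e]; ring⟩

theorem volume_rotAttractor (hl0 : 0 < l) (hl1 : l < 1) (hθ : Irrational θ)
    (hθ0 : 0 < θ) (hθ1 : θ < 1) : MeasureTheory.volume (rotAttractor l θ) = 0 := by
  set C := rotAttractor l θ with hC
  set c := saltus l θ (1 - θ)
  have hfin : MeasureTheory.volume C ≠ ⊤ :=
    ((MeasureTheory.measure_mono (rotAttractor_subset_Icc hl0 hl1 hθ)).trans_lt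
      measure_Icc_lt_top).ne
  have hIic : MeasureTheory.volume (C ∩ Set.Iic c) = MeasureTheory.volume (C ∩ Set.Iio c) :=
    MeasureTheory.measure_congr
      (MeasureTheory.ae_eq_set_inter Filter.EventuallyEq.rfl MeasureTheory.Iio_ae_eq_Iic.symm)
  have hsplit : MeasureTheory.volume (C ∩ Set.Iic c) + MeasureTheory.volume (C ∩ Set.Ici c) =
      MeasureTheory.volume C := by
    rw [hIic, ← MeasureTheory.measure_inter_add_sdiff C (measurableSet_Iio (a := c)),
      Set.sdiff_eq, Set.compl_Iio]
  have hle : MeasureTheory.volume C ≤ ENNReal.ofReal l * MeasureTheory.volume C := by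
    calc MeasureTheory.volume C ≤ _ :=
          MeasureTheory.measure_mono (rotAttractor_subset_union_image hl0 hl1 hθ hθ0 hθ1)
      _ ≤ _ := MeasureTheory.measure_union_le _ _
      _ = ENNReal.ofReal l * MeasureTheory.volume C := by
          rw [volume_image_mul_add hl0, volume_image_mul_add hl0, ← mul_add, hsplit]
  by_contra h0
  have : ENNReal.ofReal l * MeasureTheory.volume C < 1 * MeasureTheory.volume C :=
    (ENNReal.mul_lt_mul_iff_left h0 hfin).2 (by simpa using hl1)
  rw [one_mul] at this
  exact absurd hle (not_le.2 this)

theorem interior_rotAttractor (hl0 : 0 < l) (hl1 : l < 1) (hθ : Irrational θ)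
    (hθ0 : 0 < θ) (hθ1 : θ < 1) : interior (rotAttractor l θ) = ∅ :=
  MeasureTheory.Measure.interior_eq_empty_of_null (volume_rotAttractor hl0 hl1 hθ hθ0 hθ1)

/-- Any two orbits in the range of `saltus` are eventually separated by the discontinuity. -/
theorem exists_separated (hl0 : 0 < l) (hl1 : l < 1) (hθ : Irrational θ)
    (hθ0 : 0 < θ) (hθ1 : θ < 1) {s u : ℝ} (hs : 0 ≤ s) (hsu : s < u) (hu : u < 1) :
    ∃ n : ℕ, ¬((contractedRot l (saltus l θ θ))^[n] (saltus l θ s) < (1 - saltus l θ θ) / l ↔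
      (contractedRot l (saltus l θ θ))^[n] (saltus l θ u) < (1 - saltus l θ θ) / l) := by
  by_contra! hne
  have hψ := saltus_strictMono hl0 hl1 hθ
  have hside (n : ℕ) : Int.fract (s + n * θ) < 1 - θ ↔ Int.fract (u + n * θ) < 1 - θ := by
    have h := hne n
    have es := contractedRot_iterate_saltus_fract hl0 hl1 hθ hθ0 hθ1 s n
    have eu := contractedRot_iterate_saltus_fract hl0 hl1 hθ hθ0 hθ1 u n
    rw [Int.fract_eq_self.2 ⟨hs, hsu.trans hu⟩] at es
    rw [Int.fract_eq_self.2 ⟨hs.trans hsu.le, hu⟩] at eu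
    rwa [es, eu, ← saltus_one_sub hl0 hl1 hθ0 hθ1, hψ.lt_iff_lt, hψ.lt_iff_lt] at h
  have hstep (x : ℝ) : ⌊x + θ⌋ = ⌊x⌋ + if Int.fract x < 1 - θ then 0 else 1 := by
    have hx := Int.floor_add_fract x
    have h0 := Int.fract_nonneg x
    have h1 := Int.fract_lt_one x
    split_ifs with h <;> rw [Int.floor_eq_iff] <;> push_cast <;> constructor <;> linarith
  have hfloor (n : ℕ) : ⌊s + n * θ⌋ = ⌊u + n * θ⌋ := by
    induction n with
    | zero =>
      simp only [Nat.cast_zero, zero_mul, add_zero]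
      rw [Int.floor_eq_zero_iff.2 ⟨hs, hsu.trans hu⟩,
        Int.floor_eq_zero_iff.2 ⟨hs.trans hsu.le, hu⟩]
    | succ n ih =>
      have e (x : ℝ) : x + ((n + 1 : ℕ) : ℝ) * θ = x + n * θ + θ := by push_cast; ring
      rw [e, e, hstep, hstep, ih]
      simp only [hside n]
  obtain ⟨n, m, h1, h2⟩ := hθ.exists_nat_mul_sub_int_mem_Ioo 0
    (show -u < -s by linarith)
  have h3 : ⌊s + n * θ⌋ < m := Int.floor_lt.2 (by linarith)
  have h4 : m ≤ ⌊u + n * θ⌋ := Int.le_floor.2 (by linarith)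
  linarith [hfloor n]

/-- Sensitive dependence on initial conditions on the attractor. -/
theorem exists_near_separated (hl0 : 0 < l) (hl1 : l < 1) (hθ : Irrational θ)
    (hθ0 : 0 < θ) (hθ1 : θ < 1) {y : ℝ} (hy : y ∈ rotAttractor l θ) {ε : ℝ} (hε : 0 < ε) :
    ∃ z ∈ Set.Icc (0 : ℝ) 1, ∃ k : ℕ, |z - y| < ε ∧
      1 - l ≤ |(contractedRot l (saltus l θ θ))^[k] z -
        (contractedRot l (saltus l θ θ))^[k] y| := by
  obtain ⟨_, ⟨s, hs, rfl⟩, hsy⟩ := Metric.mem_closure_iff.1 hy ε hε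
  obtain ⟨u, hsu, hu1, hu⟩ := exists_saltus_near (θ := θ) hl0 hl1 hs.2
    (Metric.isOpen_ball.mem_nhds (show saltus l θ s ∈ Metric.ball y ε by
      rwa [Metric.mem_ball, dist_comm]))
  obtain ⟨s', hs'⟩ := exists_between hsu
  have hmem : s' ∈ Set.Ico (0 : ℝ) 1 := ⟨hs.1.trans hs'.1.le, hs'.2.trans_le hu1⟩
  obtain ⟨n, hn⟩ := exists_separated hl0 hl1 hθ hθ0 hθ1 hs.1 hs'.1 hmem.2
  have key (z : ℝ) (hz : z ∈ Set.Icc (0 : ℝ) 1)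
      (h : ¬((contractedRot l (saltus l θ θ))^[n] z < (1 - saltus l θ θ) / l ↔
        (contractedRot l (saltus l θ θ))^[n] y < (1 - saltus l θ θ) / l)) :
      1 - l ≤ |(contractedRot l (saltus l θ θ))^[n + 1] z -
        (contractedRot l (saltus l θ θ))^[n + 1] y| := by
    rw [Function.iterate_succ_apply', Function.iterate_succ_apply']
    have hI {x : ℝ} (hx : x ∈ Set.Icc (0 : ℝ) 1) :=
      contractedRot_iterate_mem_Icc hl0 (saltus_self_pos hl0 hl1 hθ hθ0).le
        (saltus_self_lt_one hl0 hl1 hθ hθ1) hl1 hx n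
    exact le_abs_contractedRot_sub hl0 (hI hz)
      (hI (rotAttractor_subset_Icc hl0 hl1 hθ hy)) h
  have hI {x : ℝ} (hx : x ∈ Set.Ico (0 : ℝ) 1) : saltus l θ x ∈ Set.Icc (0 : ℝ) 1 :=
    Set.Ico_subset_Icc_self (saltus_mem_Ico hl0 hl1 hθ hx)
  by_cases h : ((contractedRot l (saltus l θ θ))^[n] (saltus l θ s) < (1 - saltus l θ θ) / l ↔
      (contractedRot l (saltus l θ θ))^[n] y < (1 - saltus l θ θ) / l)
  · refine ⟨saltus l θ s', hI hmem, n + 1, ?_, key _ (hI hmem) fun h' => hn (h.trans h'.symm)⟩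
    simpa [Real.dist_eq] using hu s' hs'
  · refine ⟨saltus l θ s, hI hs, n + 1, ?_, key _ (hI hs) h⟩
    rwa [dist_comm, Real.dist_eq] at hsy

end Attractor

section FibonacciMap

theorem fibDelta_eq_saltus {b : ℝ} (hb : 1 < b) :
    fibDelta b = saltus (1 / b) (2 - Real.goldenRatio) (2 - Real.goldenRatio) := by
  have hl0 : 0 < 1 / b := by positivity
  have hl1 : 1 / b < 1 := by rw [div_lt_one (by linarith)]; exact hb
  have h := saltus_add_self (θ := 2 - Real.goldenRatio) hl0 hl1 0
  have e (k : ℕ) : (1 / b) ^ (k + 1) * ((⌊0 - ((k : ℝ) + 1) * (2 - Real.goldenRatio)⌋ -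
      ⌊-(((k : ℝ) + 2) * (2 - Real.goldenRatio))⌋ : ℤ) : ℝ) =
      1 / b * ((fibWord k : ℝ) * (1 / b) ^ k) := by
    have h1 : (0 : ℝ) - ((k : ℝ) + 1) * (2 - Real.goldenRatio) =
        ((k : ℝ) + 1) * Real.goldenRatio - ((2 * (k + 1) : ℤ) : ℝ) := by push_cast; ring
    have h2 : -(((k : ℝ) + 2) * (2 - Real.goldenRatio)) =
        ((k : ℝ) + 2) * Real.goldenRatio - ((2 * (k + 2) : ℤ) : ℝ) := by push_cast; ring
    rw [h1, h2, Int.floor_sub_intCast, Int.floor_sub_intCast, fibWord]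
    push_cast
    ring
  have hf : ⌊-(2 - Real.goldenRatio)⌋ = -1 := by
    rw [Int.floor_eq_iff]
    push_cast
    constructor <;> linarith [Real.one_lt_goldenRatio, Real.goldenRatio_lt_two]
  rw [zero_add, tsum_congr e, tsum_mul_left, hf, Int.floor_zero] at h
  rw [h, fibDelta]
  push_cast
  ring

theorem semiconj_contractedRot_fibMap {b : ℝ} (hb : 1 < b) :
    Function.Semiconj (fun y => 500 * y + (rhoParam b / b + 500))
      (contractedRot (1 / b) (fibDelta b)) (fibMap b) := by
  intro y
  have hb0 : b ≠ 0 := by linarith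
  have hb1 : b - 1 ≠ 0 := by linarith
  have hρ : rhoParam b - rhoParam b / b = 500 * (b * (1 - fibDelta b) + 1) := by
    rw [rhoParam]
    field_simp
  have hρ' : (1 / b) * (rhoParam b / b) = rhoParam b / b - 500 * (1 - fibDelta b + 1 / b) := by
    rw [rhoParam]
    field_simp
    ring
  have hc : (1 - fibDelta b) / (1 / b) = b * (1 - fibDelta b) := by field_simp
  have hiff : 500 * y + (rhoParam b / b + 500) < rhoParam b ↔
      y < (1 - fibDelta b) / (1 / b) := by
    rw [hc]
    constructor <;> intro h <;> linarith
  simp only [fibMap, pwc, contractedRot, hiff]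
  split_ifs <;> linear_combination -hρ'

end FibonacciMap

theorem stmt2 (b : ℝ) (hb : 1 < b) :
    ∃ C : Set ℝ, IsCantorSet C ∧ C ⊆ Set.Ici 0 ∧
      (∀ S₀ : ℝ, 0 ≤ S₀ → omegaLim (fibMap b) S₀ = C) ∧
      0 < 500 * (1 - 1 / b) ∧
      ∀ S₀ ∈ C, ∀ ε : ℝ, 0 < ε → ∃ S₀' : ℝ, ∃ k : ℕ, 0 ≤ S₀' ∧ |S₀' - S₀| ≤ ε ∧
        500 * (1 - 1 / b) ≤ |(fibMap b)^[k] S₀' - (fibMap b)^[k] S₀| := by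
  have hl0 : 0 < 1 / b := by positivity
  have hl1 : 1 / b < 1 := by rw [div_lt_one (by linarith)]; exact hb
  have hθ : Irrational (2 - Real.goldenRatio) := by
    simpa using Real.goldenRatio_irrational.natCast_sub 2
  have hθ0 : 0 < 2 - Real.goldenRatio := by linarith [Real.goldenRatio_lt_two]
  have hθ1 : 2 - Real.goldenRatio < 1 := by linarith [Real.one_lt_goldenRatio]
  have hδ := fibDelta_eq_saltus hb
  have hsc := semiconj_contractedRot_fibMap hb
  set h : ℝ ≃ₜ ℝ := affineHomeomorph 500 (rhoParam b / b + 500) (by norm_num)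
  replace hsc : Function.Semiconj h (contractedRot (1 / b) (fibDelta b)) (fibMap b) := hsc
  have happly (y : ℝ) : h y = 500 * y + (rhoParam b / b + 500) := rfl
  have hpos : 0 ≤ rhoParam b / b := by
    have h1 : fibDelta b < 1 := hδ ▸ saltus_self_lt_one hl0 hl1 hθ hθ1
    have h2 : 0 < 1 - fibDelta b := by linarith
    have h3 : 0 < b - 1 := by linarith
    unfold rhoParam
    positivity
  rw [hδ] at hsc
  generalize 2 - Real.goldenRatio = θ at *
  have hsub := rotAttractor_subset_Icc hl0 hl1 hθ
  have hperf := perfect_rotAttractor hl0 hl1 hθ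
  have hclosed : IsClosed (h '' rotAttractor (1 / b) θ) := h.isClosedMap _ hperf.closed
  refine ⟨h '' rotAttractor (1 / b) θ, ⟨?_, ?_, ⟨hclosed, ?_⟩, ?_⟩, ?_, fun S₀ _ => ?_,
    by linarith, ?_⟩
  · exact Set.Nonempty.image _ ⟨_, subset_closure ⟨0, ⟨le_rfl, one_pos⟩, rfl⟩⟩
  · exact (isCompact_Icc.of_isClosed_subset hperf.closed hsub).image h.continuous
  · rintro _ ⟨y, hy, rfl⟩
    simpa using (hperf.acc y hy).map h.continuous.continuousAt h.injective
  · rw [hclosed.isNowhereDense_iff, ← h.image_interior,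
      interior_rotAttractor hl0 hl1 hθ hθ0 hθ1, Set.image_empty]
  · rintro _ ⟨y, hy, rfl⟩
    rw [Set.mem_Ici, happly]
    linarith [(hsub hy).1]
  · rw [← h.apply_symm_apply S₀, omegaLim_image h hsc,
      omegaLim_contractedRot hl0 hl1 hθ hθ0 hθ1]
  · rintro _ ⟨y, hy, rfl⟩ ε hε
    obtain ⟨z, hz, k, hzy, hk⟩ := exists_near_separated hl0 hl1 hθ hθ0 hθ1 hy
      (show 0 < ε / 500 by linarith)
    have hd (u v : ℝ) : |h u - h v| = 500 * |u - v| := by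
      rw [happly, happly, add_sub_add_right_eq_sub, ← mul_sub, abs_mul]
      norm_num
    refine ⟨h z, k, ?_, ?_, ?_⟩
    · rw [happly]
      linarith [hz.1]
    · rw [hd]
      linarith
    · rw [← (hsc.iterate_right k).eq, ← (hsc.iterate_right k).eq, hd]
      linarith
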